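/- Prescribing derivatives of a fixed configuration-space function along trajectories by choice of potential (core of the genericity theorem for potentials, constant-metric case): let n ≥ 1 and let G be a symmetric positive-definite n × n real matrix (the inverse mass metric). Let q₀, p₀ ∈ ℝⁿ with p₀ ≠ 0, let F : ℝⁿ → ℝ be C^∞ with fderiv ℝ F q₀ ≠ 0, let c ∈ ℝ and w ∈ ℝⁿ be a prescribed value and gradient, and let m ≥ 3 with prescribed values v₃, …, v_m ∈ ℝ. Then there exists a C^∞ potential V : ℝⁿ → ℝ with V(q₀) = c and ∇V(q₀) = w such that every solution (q(t), p(t)) of the equations q̇(t) = G·p(t), ṗ(t) = -∇V(q(t)) on a neighbourhood of 0 with q(0) = q₀ and p(0) = p₀ satisfies deriv^[k] (F ∘ q) 0 = v_k for all k with 3 ≤ k ≤ m. -/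

import Mathlib

/-- The gradient of `V : ℝⁿ → ℝ` with respect to the standard inner product on `ℝⁿ`:
`(∇V(q))ᵢ = ∂V/∂qᵢ = (fderiv ℝ V q)(eᵢ)`. -/
noncomputable def stdGrad {n : ℕ} (V : (Fin n → ℝ) → ℝ) (q : Fin n → ℝ) : Fin n → ℝ :=
  fun i => fderiv ℝ V q (Pi.single i 1)

/-- Lie derivative of a function along a vector field. -/
noncomputable def lieD {Z : Type*} [NormedAddCommGroup Z] [NormedSpace ℝ Z]
    (Y : Z → Z) (f : Z → ℝ) : Z → ℝ := fun z => fderiv ℝ f z (Y z)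

section lie
variable {Z : Type*} [NormedAddCommGroup Z] [NormedSpace ℝ Z]

theorem lieD_contDiff {Y : Z → Z} {f : Z → ℝ} (hY : ContDiff ℝ (⊤ : ℕ∞) Y)
    (hf : ContDiff ℝ (⊤ : ℕ∞) f) : ContDiff ℝ (⊤ : ℕ∞) (lieD Y f) := by
  have h : ContDiff ℝ (⊤ : ℕ∞) (fderiv ℝ f) := hf.fderiv_right (by simp)
  exact h.clm_apply hY

theorem lieD_iter_contDiff {Y : Z → Z} {f : Z → ℝ} (hY : ContDiff ℝ (⊤ : ℕ∞) Y)
    (hf : ContDiff ℝ (⊤ : ℕ∞) f) (k : ℕ) : ContDiff ℝ (⊤ : ℕ∞) ((lieD Y)^[k] f) := by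
  induction k with
  | zero => exact hf
  | succ k ih => rw [Function.iterate_succ_apply']; exact lieD_contDiff hY ih

theorem lieD_add_smul (Y D : Z → Z) (a : Z → ℝ) (f : Z → ℝ) :
    lieD (fun z => Y z + a z • D z) f = fun z => lieD Y f z + a z * lieD D f z := by
  funext z; simp [lieD]

theorem lieD_add_mul_pow (Y : Z → Z) {f A l : Z → ℝ} (hf : ContDiff ℝ (⊤ : ℕ∞) f)
    (hA : ContDiff ℝ (⊤ : ℕ∞) A) (hl : ContDiff ℝ (⊤ : ℕ∞) l) (j : ℕ) :
    lieD Y (fun z => f z + A z * l z ^ (j + 1)) =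
      fun z => lieD Y f z + (lieD Y A z * l z + (j + 1 : ℝ) * A z * lieD Y l z) * l z ^ j := by
  funext z
  have h1 := (hf.differentiable (by simp) z).hasFDerivAt
  have h2 := (hA.differentiable (by simp) z).hasFDerivAt
  have h3 := (hl.differentiable (by simp) z).hasFDerivAt
  have h := h1.add (h2.mul (h3.pow (j + 1)))
  have h' : fderiv ℝ (fun z => f z + A z * l z ^ (j + 1)) z = _ := h.fderiv
  simp only [lieD]
  rw [h']
  simp
  ring

theorem lieD_key {Y D : Z → Z} {f l : Z → ℝ} (hY : ContDiff ℝ (⊤ : ℕ∞) Y)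
    (hD : ContDiff ℝ (⊤ : ℕ∞) D) (hf : ContDiff ℝ (⊤ : ℕ∞) f) (hl : ContDiff ℝ (⊤ : ℕ∞) l)
    (z₀ : Z) (hl0 : l z₀ = 0) (hDf : ∀ z, lieD D f z = 0) (N : ℕ) (hN : 1 ≤ N) (k : ℕ)
    (hk : k ≤ N) :
    ∃ A : Z → ℝ, ContDiff ℝ (⊤ : ℕ∞) A ∧
      (lieD (fun z => Y z + l z ^ N • D z))^[k + 2] f =
        (fun z => (lieD Y)^[k + 2] f z + A z * l z ^ (N - k)) ∧
      A z₀ = (N.descFactorial k : ℝ) * lieD Y l z₀ ^ k * lieD D (lieD Y f) z₀ := by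
  have hY' : ContDiff ℝ (⊤ : ℕ∞) (fun z => Y z + l z ^ N • D z) :=
    hY.add ((hl.pow N).smul hD)
  induction k with
  | zero =>
    refine ⟨lieD D (lieD Y f), lieD_contDiff hD (lieD_contDiff hY hf), ?_, by simp⟩
    simp only [Function.iterate_succ_apply', Function.iterate_zero, id, zero_add]
    have : lieD (fun z => Y z + l z ^ N • D z) f = lieD Y f := by
      rw [lieD_add_smul]; funext z; simp [hDf]
    rw [this, lieD_add_smul]
    funext z
    simp [mul_comm]
  | succ k ih =>
    obtain ⟨A, hA, hEq, hA0⟩ := ih (by omega)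
    obtain ⟨j, rfl⟩ : ∃ j, N = k + 1 + j := ⟨N - (k + 1), by omega⟩
    have hj : k + 1 + j - k = j + 1 := by omega
    have hj' : k + 1 + j - (k + 1) = j := by omega
    rw [hj] at hEq
    rw [hj']
    set Y' : Z → Z := fun z => Y z + l z ^ (k + 1 + j) • D z with hY'def
    have hsm := lieD_iter_contDiff hY hf (k + 2)
    refine ⟨fun z => l z ^ (k + 1) * lieD D ((lieD Y)^[k + 2] f) z +
      (lieD Y' A z * l z + (j + 1 : ℝ) * A z * lieD Y' l z), ?_, ?_, ?_⟩
    · exact ((hl.pow _).mul (lieD_contDiff hD hsm)).add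
        (((lieD_contDiff hY' hA).mul hl).add
          ((contDiff_const.mul hA).mul (lieD_contDiff hY' hl)))
    · rw [show k + 1 + 2 = (k + 2) + 1 by ring, Function.iterate_succ_apply', hEq,
        lieD_add_mul_pow Y' hsm hA hl j]
      funext z
      rw [Function.iterate_succ_apply' (lieD Y) (k + 2)]
      have : lieD Y' ((lieD Y)^[k + 2] f) z = lieD Y ((lieD Y)^[k + 2] f) z +
          l z ^ (k + 1 + j) * lieD D ((lieD Y)^[k + 2] f) z := by
        rw [hY'def, lieD_add_smul]
      rw [this]
      ring
    · have : lieD Y' l z₀ = lieD Y l z₀ := by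
        simp only [hY'def, lieD, hl0]
        simp [show k + 1 + j ≠ 0 by omega]
      simp only [this, hl0, hA0, Nat.descFactorial_succ, hj]
      push_cast
      ring

theorem deriv_iter_eq (Y : Z → Z) {f : Z → ℝ} (hY : ContDiff ℝ (⊤ : ℕ∞) Y)
    (hf : ContDiff ℝ (⊤ : ℕ∞) f) (z : ℝ → Z)
    (hz : ∀ᶠ t in nhds (0 : ℝ), HasDerivAt z (Y (z t)) t) (k : ℕ) :
    ∀ᶠ t in nhds (0 : ℝ), deriv^[k] (f ∘ z) t = (lieD Y)^[k] f (z t) := by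
  induction k with
  | zero => simp
  | succ k ih =>
    filter_upwards [ih.eventually_nhds, hz] with t h1 h2
    rw [Function.iterate_succ_apply', Function.iterate_succ_apply']
    have h1' : deriv^[k] (f ∘ z) =ᶠ[nhds t] fun t => (lieD Y)^[k] f (z t) := h1
    rw [h1'.deriv_eq]
    have h3 := ((lieD_iter_contDiff hY hf k).differentiable (by simp) (z t)).hasFDerivAt
    exact (h3.comp_hasDerivAt t h2).deriv

end lie

/-- The Hamiltonian vector field. -/
noncomputable def hamX {n : ℕ} (G : Matrix (Fin n) (Fin n) ℝ) (V : (Fin n → ℝ) → ℝ) :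
    (Fin n → ℝ) × (Fin n → ℝ) → (Fin n → ℝ) × (Fin n → ℝ) :=
  fun z => (G.mulVec z.2, -(stdGrad V z.1))

theorem contDiff_dot {n : ℕ} (a q₀ : Fin n → ℝ) :
    ContDiff ℝ (⊤ : ℕ∞) (fun q : Fin n → ℝ => a ⬝ᵥ (q - q₀)) := by
  unfold dotProduct
  simp only [Pi.sub_apply]
  fun_prop

theorem hasFDerivAt_dot {n : ℕ} (a q₀ q : Fin n → ℝ) :
    HasFDerivAt (fun q : Fin n → ℝ => a ⬝ᵥ (q - q₀))
      (LinearMap.toContinuousLinearMap (dotProductBilin ℝ ℝ a)) q := by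
  have h := ((LinearMap.toContinuousLinearMap (dotProductBilin ℝ ℝ a)).hasFDerivAt
    (x := q - q₀)).comp q ((hasFDerivAt_id q).sub_const q₀)
  exact h

theorem hamX_contDiff {n : ℕ} (G : Matrix (Fin n) (Fin n) ℝ) {V : (Fin n → ℝ) → ℝ}
    (hV : ContDiff ℝ (⊤ : ℕ∞) V) : ContDiff ℝ (⊤ : ℕ∞) (hamX G V) := by
  unfold hamX
  refine ContDiff.prodMk ?_ ?_
  · exact (LinearMap.toContinuousLinearMap G.mulVecLin).contDiff.comp contDiff_snd
  · refine ContDiff.neg (contDiff_pi.2 fun i => ?_)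
    have h : ContDiff ℝ (⊤ : ℕ∞) (fderiv ℝ V) := hV.fderiv_right (by simp)
    exact (h.comp contDiff_fst).clm_apply contDiff_const

theorem stdGrad_add_pow {n : ℕ} {V : (Fin n → ℝ) → ℝ} (hV : ContDiff ℝ (⊤ : ℕ∞) V)
    (a q₀ q : Fin n → ℝ) (b : ℝ) (N : ℕ) :
    stdGrad (fun q => V q + b * (a ⬝ᵥ (q - q₀)) ^ (N + 1)) q =
      stdGrad V q + ((a ⬝ᵥ (q - q₀)) ^ N) • ((b * (N + 1)) • a) := by
  funext i
  have h1 := (hV.differentiable (by simp) q).hasFDerivAt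
  have h := h1.add (((hasFDerivAt_dot a q₀ q).pow (N + 1)).const_mul b)
  have h' : fderiv ℝ (fun q => V q + b * (a ⬝ᵥ (q - q₀)) ^ (N + 1)) q = _ := h.fderiv
  simp only [stdGrad]
  rw [h']
  simp [stdGrad]
  ring

theorem exists_both {E : Type*} [AddCommGroup E] (f g : E →+ ℝ) (x y : E)
    (hx : f x ≠ 0) (hy : g y ≠ 0) : ∃ z, f z ≠ 0 ∧ g z ≠ 0 := by
  by_cases h1 : g x = 0
  · by_cases h2 : f y = 0
    · exact ⟨x + y, by simpa [h2] using hx, by simpa [h1] using hy⟩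
    · exact ⟨y, h2, hy⟩
  · exact ⟨x, hx, h1⟩

theorem exists_jet {n : ℕ} (G : Matrix (Fin n) (Fin n) ℝ) (q₀ p₀ : Fin n → ℝ)
    (F : (Fin n → ℝ) → ℝ) (hF : ContDiff ℝ (⊤ : ℕ∞) F) (a : Fin n → ℝ)
    (ha1 : a ⬝ᵥ (G.mulVec p₀) ≠ 0) (ha2 : fderiv ℝ F q₀ (G.mulVec a) ≠ 0)
    (c : ℝ) (w : Fin n → ℝ) (v : ℕ → ℝ) (M : ℕ) :
    ∃ V : (Fin n → ℝ) → ℝ, ContDiff ℝ (⊤ : ℕ∞) V ∧ V q₀ = c ∧ stdGrad V q₀ = w ∧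
      ∀ k, 3 ≤ k → k ≤ M + 2 →
        (lieD (hamX G V))^[k] (fun z => F z.1) (q₀, p₀) = v k := by
  induction M with
  | zero =>
    refine ⟨fun q => c + w ⬝ᵥ (q - q₀), contDiff_const.add (contDiff_dot w q₀), by simp, ?_, ?_⟩
    · funext i
      have h' : fderiv ℝ (fun q => c + w ⬝ᵥ (q - q₀)) q₀ = _ :=
        ((hasFDerivAt_dot w q₀ q₀).const_add c).fderiv
      simp only [stdGrad]
      rw [h']
      simp
    · intro k h1 h2; omega
  | succ M ih =>
    obtain ⟨V, hV, hV0, hVw, hVk⟩ := ih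
    have hf : ContDiff ℝ (⊤ : ℕ∞) (fun z : (Fin n → ℝ) × (Fin n → ℝ) => F z.1) :=
      hF.comp contDiff_fst
    set f : (Fin n → ℝ) × (Fin n → ℝ) → ℝ := fun z => F z.1 with hfdef
    set l : (Fin n → ℝ) × (Fin n → ℝ) → ℝ := fun z => a ⬝ᵥ (z.1 - q₀) with hldef
    have hl : ContDiff ℝ (⊤ : ℕ∞) l := (contDiff_dot a q₀).comp contDiff_fst
    have hl0 : l (q₀, p₀) = 0 := by simp [hldef]
    have hX := hamX_contDiff G hV
    have hlX : lieD (hamX G V) l (q₀, p₀) = a ⬝ᵥ (G.mulVec p₀) := by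
      have h := (hasFDerivAt_dot a q₀ q₀).comp (q₀, p₀)
        (hasFDerivAt_fst (𝕜 := ℝ) (E := Fin n → ℝ) (F := Fin n → ℝ) (p := (q₀, p₀)))
      have h' : fderiv ℝ l (q₀, p₀) = _ := h.fderiv
      simp only [lieD]
      rw [h']
      simp [hamX]
    have hfd : ∀ z, fderiv ℝ f z =
        (fderiv ℝ F z.1).comp (ContinuousLinearMap.fst ℝ (Fin n → ℝ) (Fin n → ℝ)) := by
      intro z
      have h := ((hF.differentiable (by simp) z.1).hasFDerivAt).comp z
        (hasFDerivAt_fst (𝕜 := ℝ) (E := Fin n → ℝ) (F := Fin n → ℝ) (p := z))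
      exact h.fderiv
    have hDf : ∀ (r : ℝ) z, lieD (fun _ => ((0 : Fin n → ℝ), r • a)) f z = 0 := by
      intro r z
      simp only [lieD]
      rw [hfd]
      simp
    have hDXf : ∀ r : ℝ, lieD (fun _ => ((0 : Fin n → ℝ), r • a)) (lieD (hamX G V) f) (q₀, p₀)
        = r * fderiv ℝ F q₀ (G.mulVec a) := by
      intro r
      have e : lieD (hamX G V) f = fun z => fderiv ℝ F z.1 (G.mulVec z.2) := by
        funext z
        simp only [lieD]
        rw [hfd]
        simp [hamX]
      have h2 : ContDiff ℝ (⊤ : ℕ∞) (fderiv ℝ F) := hF.fderiv_right (by simp)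
      have h3 := ((h2.differentiable (by simp) q₀).hasFDerivAt).comp (q₀, p₀)
        (hasFDerivAt_fst (𝕜 := ℝ) (E := Fin n → ℝ) (F := Fin n → ℝ) (p := (q₀, p₀)))
      have h4 := ((LinearMap.toContinuousLinearMap G.mulVecLin).hasFDerivAt (x := p₀)).comp
        (q₀, p₀)
        (hasFDerivAt_snd (𝕜 := ℝ) (E := Fin n → ℝ) (F := Fin n → ℝ) (p := (q₀, p₀)))
      have h5 := h3.clm_apply h4
      have h6 : fderiv ℝ (fun z : (Fin n → ℝ) × (Fin n → ℝ) =>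
        fderiv ℝ F z.1 (G.mulVec z.2)) (q₀, p₀) = _ := h5.fderiv
      rw [e]
      simp only [lieD]
      rw [h6]
      simp [Matrix.mulVec_smul]
    set κ : ℝ := ((M + 1).factorial : ℝ) * (a ⬝ᵥ (G.mulVec p₀)) ^ (M + 1) *
      fderiv ℝ F q₀ (G.mulVec a) with hκ
    have hκ0 : κ ≠ 0 := by
      have : ((M + 1).factorial : ℝ) ≠ 0 := by exact_mod_cast (M + 1).factorial_ne_zero
      exact mul_ne_zero (mul_ne_zero this (pow_ne_zero _ ha1)) ha2
    set r : ℝ := (v (M + 3) - (lieD (hamX G V))^[M + 3] f (q₀, p₀)) / κ with hr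
    set b : ℝ := -r / (((M + 1 : ℕ) : ℝ) + 1) with hb
    have hbr : b * (((M + 1 : ℕ) : ℝ) + 1) = -r := by
      rw [hb]; field_simp
    set V' : (Fin n → ℝ) → ℝ := fun q => V q + b * (a ⬝ᵥ (q - q₀)) ^ (M + 1 + 1) with hV'
    have hgrad : ∀ q, stdGrad V' q = stdGrad V q + ((a ⬝ᵥ (q - q₀)) ^ (M + 1)) • ((-r) • a) := by
      intro q
      rw [← hbr]
      exact stdGrad_add_pow hV a q₀ q b (M + 1)
    have hXV' : hamX G V' = fun z => hamX G V z + l z ^ (M + 1) • ((0 : Fin n → ℝ), r • a) := by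
      funext z
      simp only [hamX, hgrad]
      ext i
      · simp
      · simp [hldef]
        ring
    have key := lieD_key (D := fun _ => ((0 : Fin n → ℝ), r • a)) hX contDiff_const hf hl
      (q₀, p₀) hl0 (hDf r) (M + 1) (by omega)
    refine ⟨V', hV.add (contDiff_const.mul ((contDiff_dot a q₀).pow _)), ?_, ?_, ?_⟩
    · simp [hV', hV0]
    · rw [hgrad, hVw]; simp
    · intro k h1 h2
      obtain ⟨j, rfl⟩ : ∃ j, k = j + 2 := ⟨k - 2, by omega⟩
      obtain ⟨A, -, hEq, hA0⟩ := key j (by omega)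
      rw [hXV', hEq]
      simp only [hl0, hA0]
      rcases Nat.lt_or_ge j (M + 1) with hj | hj
      · rw [hVk (j + 2) h1 (by omega), zero_pow (by omega)]
        ring
      · obtain rfl : j = M + 1 := by omega
        rw [hDXf, hlX, Nat.descFactorial_self, Nat.sub_self, pow_zero]
        have : (((M + 1).factorial : ℝ) * (a ⬝ᵥ (G.mulVec p₀)) ^ (M + 1) *
          (r * fderiv ℝ F q₀ (G.mulVec a))) = r * κ := by rw [hκ]; ring
        rw [this, hr, div_mul_cancel₀ _ hκ0]
        ring

/-- **Prescribing derivatives of a fixed configuration-space function along trajectories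
by choice of potential** (core of the genericity theorem for potentials, constant-metric
case): let `G` be a symmetric positive-definite matrix (the inverse mass metric),
`p₀ ≠ 0`, and `F` smooth with `fderiv ℝ F q₀ ≠ 0`.  Given a prescribed value `c`,
gradient `w`, and values `v 3, …, v m` (`m ≥ 3`), there is a smooth potential `V` with
`V q₀ = c` and `∇V q₀ = w` such that every solution of `q̇ = G p`, `ṗ = -∇V(q)` near `0`
with `q 0 = q₀`, `p 0 = p₀` satisfies `deriv^[k] (F ∘ q) 0 = v k` for all `3 ≤ k ≤ m`. -/
theorem exists_smooth_potential_with_prescribed_derivs_of_F_along_trajectories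
    {n : ℕ} (hn : 1 ≤ n)
    (G : Matrix (Fin n) (Fin n) ℝ) (hGsymm : G.IsSymm) (hGpos : G.PosDef)
    (q₀ p₀ : Fin n → ℝ) (hp₀ : p₀ ≠ 0)
    (F : (Fin n → ℝ) → ℝ) (hF : ContDiff ℝ (⊤ : ℕ∞) F) (hdF : fderiv ℝ F q₀ ≠ 0)
    (c : ℝ) (w : Fin n → ℝ)
    (m : ℕ) (hm : 3 ≤ m) (v : ℕ → ℝ) :
    ∃ V : (Fin n → ℝ) → ℝ, ContDiff ℝ (⊤ : ℕ∞) V ∧ V q₀ = c ∧ stdGrad V q₀ = w ∧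
      ∀ q p : ℝ → (Fin n → ℝ),
        (∀ᶠ t in nhds (0 : ℝ), HasDerivAt q (G.mulVec (p t)) t) →
        (∀ᶠ t in nhds (0 : ℝ), HasDerivAt p (-(stdGrad V (q t))) t) →
        q 0 = q₀ → p 0 = p₀ →
        ∀ k, 3 ≤ k → k ≤ m → deriv^[k] (F ∘ q) 0 = v k := by
  have hdet : IsUnit G.det := hGpos.det_pos.ne'.isUnit
  have hu : G.mulVec p₀ ≠ 0 := by
    intro h
    apply hp₀
    have := congrArg (G⁻¹).mulVec h
    rwa [Matrix.mulVec_mulVec, Matrix.nonsing_inv_mul _ hdet, Matrix.one_mulVec,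
      Matrix.mulVec_zero] at this
  obtain ⟨y, hy⟩ : ∃ y, fderiv ℝ F q₀ y ≠ 0 := by
    by_contra! h
    exact hdF (ContinuousLinearMap.ext h)
  have hx : (G.mulVec p₀) ⬝ᵥ (G.mulVec p₀) ≠ 0 := by
    rwa [Ne, dotProduct_self_eq_zero]
  obtain ⟨a, ha1, ha2⟩ := exists_both
    ((dotProductBilin ℝ ℝ (G.mulVec p₀)).toAddMonoidHom)
    (((fderiv ℝ F q₀).toLinearMap ∘ₗ G.mulVecLin).toAddMonoidHom)
    (G.mulVec p₀) (G⁻¹.mulVec y) (by simpa using hx)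
    (by simpa [Matrix.mulVec_mulVec, Matrix.mul_nonsing_inv _ hdet] using hy)
  obtain ⟨V, hV, hV0, hVw, hVk⟩ := exists_jet G q₀ p₀ F hF a
    (by rw [dotProduct_comm]; simpa using ha1) (by simpa using ha2) c w v m
  refine ⟨V, hV, hV0, hVw, ?_⟩
  intro q p hq hp hq0 hp0 k h3 hk
  have hz : ∀ᶠ t in nhds (0 : ℝ),
      HasDerivAt (fun t => (q t, p t)) (hamX G V (q t, p t)) t := by
    filter_upwards [hq, hp] with t h1 h2
    exact h1.prodMk h2
  have h := (deriv_iter_eq (hamX G V) (f := fun z => F z.1) (hamX_contDiff G hV)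
    (hF.comp contDiff_fst) (fun t => (q t, p t)) hz k).self_of_nhds
  have h' := hVk k h3 (by omega)
  rw [hq0, hp0, h'] at h
  exact h
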